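/- Let m ≥ 1 and 0 ≤ i ≤ m. Let (c_1,…,c_p) and (d_1,…,d_r) be finite sequences of positive integers whose continued fraction values satisfy v(c_1,…,c_p) > v(d_1,…,d_r) ≥ 1. Set 𝒢 = 𝒢[c_1,…,c_p] and 𝒢' = 𝒢[d_1,…,d_r], and define the polynomials ℛ(q) = Ω_m^{m+1−i,1}(𝒢,q), 𝒮(q) = Ω_m^{m+1,1}(𝒢,q), 𝒜(q) = Ω_m^{m+1−i,1}(𝒢',q), ℬ(q) = Ω_m^{m+1,1}(𝒢',q). Then the polynomial ℛ(q)·ℬ(q) − 𝒜(q)·𝒮(q) ∈ ℤ[q] has all coefficients nonnegative. -/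

import Mathlib

open Polynomial Finset

namespace QHCF

noncomputable section

/-! ### Border strips and P-partitions -/

/-- The full alternating step list: `replicate a₁ b ++ replicate a₂ (!b) ++ ⋯`. -/
def fullSteps : List ℕ → Bool → List Bool
  | [], _ => []
  | x :: xs, b => List.replicate x b ++ fullSteps xs (!b)

/-- The step sequence of the border strip `𝒢[a₁,…,aₙ]`: `(a₁−1)` up steps (`true`),
then `a₂` right steps (`false`), then `a₃` up steps, alternating, ending with
`(aₙ−1)` final steps. -/
def steps (a : List ℕ) : List Bool := ((fullSteps a true).drop 1).dropLast

/-- The number of boxes `N = a₁+⋯+aₙ−1` of the border strip `𝒢[a₁,…,aₙ]`. -/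
def boxCount (a : List ℕ) : ℕ := a.sum - 1

/-- `σ` is a P-partition on `𝒢[a₁,…,aₙ]` with parts at most `m`:
`σ(t+1) ≤ σ(t)` on up steps and `σ(t) ≤ σ(t+1)` on right steps. -/
def IsPP (m : ℕ) (a : List ℕ) (σ : Fin (boxCount a) → Fin (m + 1)) : Prop :=
  ∀ (t : ℕ) (h : t + 1 < boxCount a),
    if (steps a).getD t true
    then ((σ ⟨t + 1, h⟩ : ℕ) ≤ (σ ⟨t, Nat.lt_of_succ_lt h⟩ : ℕ))
    else ((σ ⟨t, Nat.lt_of_succ_lt h⟩ : ℕ) ≤ (σ ⟨t + 1, h⟩ : ℕ))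

/-- The set of P-partitions on `𝒢[a₁,…,aₙ]` with parts at most `m`. -/
noncomputable def PP (m : ℕ) (a : List ℕ) : Finset (Fin (boxCount a) → Fin (m + 1)) :=
  @Finset.filter _ (IsPP m a) (Classical.decPred _) Finset.univ

/-- The weight of a P-partition: the sum of its parts. -/
def wt {N m : ℕ} (σ : Fin N → Fin (m + 1)) : ℕ := ∑ t, (σ t : ℕ)

/-- The number of P-partitions (parts at most `m`) satisfying a further predicate `p`. -/
noncomputable def PPcount (m : ℕ) (a : List ℕ)
    (p : (Fin (boxCount a) → Fin (m + 1)) → Prop) : ℕ :=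
  (@Finset.filter _ p (Classical.decPred _) (PP m a)).card

/-- The weight generating function `Σ q^{wt σ}` over P-partitions satisfying `p`. -/
noncomputable def PPgen (m : ℕ) (a : List ℕ)
    (p : (Fin (boxCount a) → Fin (m + 1)) → Prop) : Polynomial ℤ :=
  ∑ σ ∈ @Finset.filter _ p (Classical.decPred _) (PP m a), (X : Polynomial ℤ) ^ wt σ

/-- `Ω_m(𝒢,q)`: the weight generating function of all P-partitions with parts at most `m`. -/
noncomputable def Omega (m : ℕ) (a : List ℕ) : Polynomial ℤ := PPgen m a fun _ => True

/-- Generating function over P-partitions with first part `≤ b` and last part `≤ c`. -/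
noncomputable def OmegaLE (m : ℕ) (a : List ℕ) (b c : ℕ) : Polynomial ℤ :=
  PPgen m a fun σ =>
    (∀ h : 0 < boxCount a, (σ ⟨0, h⟩ : ℕ) ≤ b) ∧
    (∀ h : 0 < boxCount a, (σ ⟨boxCount a - 1, Nat.sub_lt h Nat.one_pos⟩ : ℕ) ≤ c)

/-- Generating function over P-partitions with first part `≤ b` and last part `≥ c`. -/
noncomputable def OmegaGE (m : ℕ) (a : List ℕ) (b c : ℕ) : Polynomial ℤ :=
  PPgen m a fun σ =>
    (∀ h : 0 < boxCount a, (σ ⟨0, h⟩ : ℕ) ≤ b) ∧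
    (∀ h : 0 < boxCount a, c ≤ (σ ⟨boxCount a - 1, Nat.sub_lt h Nat.one_pos⟩ : ℕ))

/-! ### Matrices over ℤ -/

/-- `R_m`, the `(m+1)×(m+1)` upper-triangular matrix of ones. -/
def Rmat (m : ℕ) : Matrix (Fin (m + 1)) (Fin (m + 1)) ℤ :=
  Matrix.of fun i j => if i ≤ j then 1 else 0

/-- `W_m`, the antidiagonal permutation matrix (`(W_m)_{ij} = 1` iff `i+j = m+2`, 1-based). -/
def Wmat (m : ℕ) : Matrix (Fin (m + 1)) (Fin (m + 1)) ℤ :=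
  Matrix.of fun i j => if (i : ℕ) + 1 + ((j : ℕ) + 1) = m + 2 then 1 else 0

/-- `Λ_m(a) = R_m^a · W_m`. -/
def Lam (m a : ℕ) : Matrix (Fin (m + 1)) (Fin (m + 1)) ℤ := Rmat m ^ a * Wmat m

/-- The product `Λ_m(a₁)Λ_m(a₂)⋯Λ_m(aₙ)`. -/
def LamProd (m : ℕ) (a : List ℕ) : Matrix (Fin (m + 1)) (Fin (m + 1)) ℤ :=
  (a.map fun x => Lam m x).prod

/-! ### q-deformed matrices over ℤ[q] (with `q = Polynomial.X`) -/

/-- `R_m` as a matrix over `ℤ[q]`. -/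
def RmatQ (m : ℕ) : Matrix (Fin (m + 1)) (Fin (m + 1)) (Polynomial ℤ) :=
  Matrix.of fun i j => if i ≤ j then 1 else 0

/-- `L_m = R_m^⊤` as a matrix over `ℤ[q]`. -/
def LmatQ (m : ℕ) : Matrix (Fin (m + 1)) (Fin (m + 1)) (Polynomial ℤ) := (RmatQ m).transpose

/-- `Q_m = diag(q^m, q^{m-1}, …, q, 1)`. -/
def Qmat (m : ℕ) : Matrix (Fin (m + 1)) (Fin (m + 1)) (Polynomial ℤ) :=
  Matrix.diagonal fun i => X ^ (m - (i : ℕ))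

/-- `R_m(q) := R_m · Q_m`. -/
def Rq (m : ℕ) : Matrix (Fin (m + 1)) (Fin (m + 1)) (Polynomial ℤ) := RmatQ m * Qmat m

/-- `L_m(q) := L_m · Q_m`. -/
def Lq (m : ℕ) : Matrix (Fin (m + 1)) (Fin (m + 1)) (Polynomial ℤ) := LmatQ m * Qmat m

/-- `W_m` as a matrix over `ℤ[q]`. -/
def WmatQ (m : ℕ) : Matrix (Fin (m + 1)) (Fin (m + 1)) (Polynomial ℤ) :=
  Matrix.of fun i j => if (i : ℕ) + 1 + ((j : ℕ) + 1) = m + 2 then 1 else 0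

/-- `Λ⁺_m(q,a) := R_m(q)^a · W_m`. -/
def LamP (m a : ℕ) : Matrix (Fin (m + 1)) (Fin (m + 1)) (Polynomial ℤ) := Rq m ^ a * WmatQ m

/-- `Λ⁻_m(q,a) := W_m · L_m(q)^a`. -/
def LamM (m a : ℕ) : Matrix (Fin (m + 1)) (Fin (m + 1)) (Polynomial ℤ) := WmatQ m * Lq m ^ a

/-- Alternating product of `Λ⁺`/`Λ⁻` matrices (`b = true` starts with `Λ⁺`). -/
def altLam (m : ℕ) : List ℕ → Bool → Matrix (Fin (m + 1)) (Fin (m + 1)) (Polynomial ℤ)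
  | [], _ => 1
  | x :: xs, b => (if b then LamP m x else LamM m x) * altLam m xs (!b)

/-- `X_𝒢(q) = Λ⁺_m(q,a₁)Λ⁻_m(q,a₂)Λ⁺_m(q,a₃)⋯`. -/
def XG (m : ℕ) (a : List ℕ) : Matrix (Fin (m + 1)) (Fin (m + 1)) (Polynomial ℤ) :=
  altLam m a true

/-- Alternating product of powers of `R_m(q)` and `L_m(q)` (`b = true` starts with `R`). -/
def altRL (m : ℕ) : List ℕ → Bool → Matrix (Fin (m + 1)) (Fin (m + 1)) (Polynomial ℤ)
  | [], _ => 1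
  | x :: xs, b => (if b then Rq m ^ x else Lq m ^ x) * altRL m xs (!b)

/-- `R_m(q)^{a₁} L_m(q)^{a₂} R_m(q)^{a₃} ⋯`. -/
def RLProd (m : ℕ) (a : List ℕ) : Matrix (Fin (m + 1)) (Fin (m + 1)) (Polynomial ℤ) :=
  altRL m a true

/-! ### Gaussian binomial coefficients -/

/-- The Gaussian binomial coefficient `binom(n,k)_q ∈ ℤ[q]`, defined via the
q-Pascal recursion `binom(n,k)_q = binom(n−1,k−1)_q + q^k·binom(n−1,k)_q`;
it equals `[n]_q!/([k]_q![n−k]_q!)`. -/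
def qbinom : ℕ → ℕ → Polynomial ℤ
  | _, 0 => 1
  | 0, _ + 1 => 0
  | n + 1, k + 1 => qbinom n k + X ^ (k + 1) * qbinom n (k + 1)

/-- The q-multichoose coefficient `mbinom(n,k)_q := binom(n+k−1,k)_q`. -/
def qmbinom (n k : ℕ) : Polynomial ℤ := qbinom (n + k - 1) k

/-! ### Higher q-continued fractions -/

/-- The higher q-continued fraction
`r^q_{i,m}(a₁,…,aₙ) := Ω_m^{m+1−i,1}(𝒢,q) · (Ω_m^{m+1,1}(𝒢,q))⁻¹ ∈ ℤ⟦q⟧`,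
i.e. the generating function over P-partitions with first part `≤ i`, divided by the
one over P-partitions with first part `= 0` (whose constant term is `1`). -/
noncomputable def rq (m i : ℕ) (a : List ℕ) : PowerSeries ℤ :=
  (↑(OmegaLE m a i m) : PowerSeries ℤ) *
    PowerSeries.invOfUnit (↑(OmegaLE m a 0 m) : PowerSeries ℤ) 1

/-- The value `v(a₁,…,aₙ)` of a finite continued fraction `a₁ + 1/(a₂ + 1/(⋯))`. -/
def cfVal : List ℕ → ℚ
  | [] => 1
  | [x] => (x : ℚ)
  | x :: y :: xs => (x : ℚ) + 1 / cfVal (y :: xs)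

end

end QHCF

open QHCF

namespace QHCF

/-! ### The transfer recursion along a word of steps -/

/-- Polynomials over `ℤ` with natural number coefficients. -/
noncomputable def nonnegCoeffs : Subsemiring ℤ[X] := (Polynomial.mapRingHom (Nat.castRingHom ℤ)).rangeS

lemma X_mem_nonnegCoeffs : (X : ℤ[X]) ∈ nonnegCoeffs := ⟨X, by simp⟩

lemma coeff_nonneg_of_mem {p : ℤ[X]} (hp : p ∈ nonnegCoeffs) (k : ℕ) : 0 ≤ p.coeff k := by
  obtain ⟨r, rfl⟩ := hp
  simp

/-- The sum of `q^y · f y` over `y ∈ A`. -/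
noncomputable def weightedSum {m : ℕ} (A : Finset (Fin (m + 1))) (f : Fin (m + 1) → ℤ[X]) : ℤ[X] :=
  ∑ y ∈ A, X ^ (y : ℕ) * f y

/-- The values reachable from `x` by a step: `y ≤ x` for an up step (`true`), `x ≤ y` for a
right step (`false`). -/
def stepRange {m : ℕ} : Bool → Fin (m + 1) → Finset (Fin (m + 1))
  | true, x => Finset.Iic x
  | false, x => Finset.Ici x

/-- The weight generating function of the sequences of values following `x` along the word `w`. -/
noncomputable def transfer (m : ℕ) : List Bool → Fin (m + 1) → ℤ[X]
  | [], _ => 1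
  | b :: w, x => weightedSum (stepRange b x) (transfer m w)

lemma weightedSum_mem {m : ℕ} (A : Finset (Fin (m + 1))) {f : Fin (m + 1) → ℤ[X]}
    (hf : ∀ x, f x ∈ nonnegCoeffs) : weightedSum A f ∈ nonnegCoeffs :=
  sum_mem fun y _ => mul_mem (pow_mem X_mem_nonnegCoeffs _) (hf y)

lemma transfer_mem (m : ℕ) (w : List Bool) (x : Fin (m + 1)) :
    transfer m w x ∈ nonnegCoeffs := by
  induction w generalizing x with
  | nil => exact one_mem _
  | cons b w ih => exact weightedSum_mem _ ih

/-- All `2 × 2` minors of the pair `(f, g)` have nonnegative coefficients. -/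
def MinorsNonneg {m : ℕ} (f g : Fin (m + 1) → ℤ[X]) : Prop :=
  ∀ ⦃i j : Fin (m + 1)⦄, j ≤ i → f i * g j - g i * f j ∈ nonnegCoeffs

lemma weightedSum_minor_mem {m : ℕ} {f g : Fin (m + 1) → ℤ[X]} (h : MinorsNonneg f g)
    {A B : Finset (Fin (m + 1))} (hAB : ∀ y ∈ A, ∀ z ∈ B, z ≤ y) :
    weightedSum A f * weightedSum B g - weightedSum A g * weightedSum B f ∈ nonnegCoeffs := by
  simp only [weightedSum, Finset.sum_mul_sum, ← Finset.sum_sub_distrib]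
  refine sum_mem fun y hy => sum_mem fun z hz => ?_
  have := mul_mem (mul_mem (pow_mem X_mem_nonnegCoeffs (y : ℕ))
    (pow_mem X_mem_nonnegCoeffs (z : ℕ))) (h (hAB y hy z hz))
  convert this using 1
  ring

lemma weightedSum_Iic_split {m : ℕ} (f : Fin (m + 1) → ℤ[X]) {i j : Fin (m + 1)} (h : j ≤ i) :
    weightedSum (Iic i) f = weightedSum (Ioc j i) f + weightedSum (Iic j) f := by
  rw [weightedSum, weightedSum, weightedSum, ← Finset.sum_union]
  · congr 1
    ext y
    simp only [mem_union, mem_Iic, mem_Ioc]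
    grind
  · rw [Finset.disjoint_left]
    simp only [mem_Iic, mem_Ioc]
    grind

lemma weightedSum_Ici_split {m : ℕ} (f : Fin (m + 1) → ℤ[X]) {i j : Fin (m + 1)} (h : j ≤ i) :
    weightedSum (Ici j) f = weightedSum (Ici i) f + weightedSum (Ico j i) f := by
  rw [weightedSum, weightedSum, weightedSum, ← Finset.sum_union]
  · congr 1
    ext y
    simp only [mem_union, mem_Ici, mem_Ico]
    grind
  · rw [Finset.disjoint_left]
    simp only [mem_Ici, mem_Ico]
    grind

/-- Both step operators are totally nonnegative of order two. -/
lemma MinorsNonneg.weightedSum_stepRange {m : ℕ} {f g : Fin (m + 1) → ℤ[X]}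
    (h : MinorsNonneg f g) (b : Bool) :
    MinorsNonneg (fun x => weightedSum (stepRange b x) f)
      (fun x => weightedSum (stepRange b x) g) := by
  intro i j hij
  cases b
  · have := weightedSum_minor_mem h (A := Ici i) (B := Ico j i)
      (by simp only [mem_Ici, mem_Ico]; grind)
    simp only [stepRange, weightedSum_Ici_split _ hij]
    convert this using 1
    ring
  · have := weightedSum_minor_mem h (A := Ioc j i) (B := Iic j)
      (by simp only [mem_Iic, mem_Ioc]; grind)
    simp only [stepRange, weightedSum_Iic_split _ hij]
    convert this using 1
    ring

/-- A coefficientwise increasing `f` and a coefficientwise decreasing `g` have nonnegative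
minors. -/
lemma minorsNonneg_of_monotone_of_antitone {m : ℕ} {f g : Fin (m + 1) → ℤ[X]}
    (hf : ∀ x, f x ∈ nonnegCoeffs) (hg : ∀ x, g x ∈ nonnegCoeffs)
    (hf' : ∀ ⦃i j⦄, j ≤ i → f i - f j ∈ nonnegCoeffs)
    (hg' : ∀ ⦃i j⦄, j ≤ i → g j - g i ∈ nonnegCoeffs) : MinorsNonneg f g := by
  intro i j hij
  have := add_mem (mul_mem (hf' hij) (hg j)) (mul_mem (hf j) (hg' hij))
  convert this using 1
  ring

lemma transfer_true_sub_mem {m : ℕ} (w : List Bool) ⦃i j : Fin (m + 1)⦄ (h : j ≤ i) :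
    transfer m (true :: w) i - transfer m (true :: w) j ∈ nonnegCoeffs := by
  simp only [transfer, stepRange, weightedSum_Iic_split _ h, add_sub_cancel_right]
  exact weightedSum_mem _ (transfer_mem m w)

lemma transfer_false_sub_mem {m : ℕ} (w : List Bool) ⦃i j : Fin (m + 1)⦄ (h : j ≤ i) :
    transfer m (false :: w) j - transfer m (false :: w) i ∈ nonnegCoeffs := by
  simp only [transfer, stepRange, weightedSum_Ici_split _ h, add_sub_cancel_left]
  exact weightedSum_mem _ (transfer_mem m w)

lemma transfer_nil_sub_mem {m : ℕ} (i j : Fin (m + 1)) :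
    transfer m [] i - transfer m [] j ∈ nonnegCoeffs := by
  simp [transfer]

/-! ### Words as paths in the Stern–Brocot tree -/

/-- The rational number at the end of the path `w` in the Stern–Brocot tree. -/
def pathVal : List Bool → ℚ
  | [] => 1
  | true :: w => 1 + pathVal w
  | false :: w => pathVal w / (1 + pathVal w)

lemma pathVal_pos (w : List Bool) : 0 < pathVal w := by
  induction w with
  | nil => simp [pathVal]
  | cons b w ih => cases b <;> simp only [pathVal] <;> positivity

lemma pathVal_false_lt_one (w : List Bool) : pathVal (false :: w) < 1 := by
  have := pathVal_pos w
  rw [pathVal, div_lt_one (by positivity)]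
  linarith

lemma one_lt_pathVal_true (w : List Bool) : 1 < pathVal (true :: w) := by
  have := pathVal_pos w
  rw [pathVal]
  linarith

lemma pathVal_map_not (w : List Bool) : pathVal (w.map not) = (pathVal w)⁻¹ := by
  induction w with
  | nil => simp [pathVal]
  | cons b w ih =>
    have := pathVal_pos w
    cases b
    · simp only [List.map_cons, Bool.not_false, pathVal, ih]
      field_simp
      ring
    · simp only [List.map_cons, Bool.not_true, pathVal, ih]
      field_simp
      ring

lemma pathVal_replicate_true_append (n : ℕ) (w : List Bool) :
    pathVal (List.replicate n true ++ w) = n + pathVal w := by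
  induction n with
  | zero => simp
  | succ n ih =>
    rw [List.replicate_succ, List.cons_append, pathVal, ih]
    push_cast
    ring

/-- The transfer functions are ordered in the same way as the Stern–Brocot values. -/
lemma minorsNonneg_transfer (m : ℕ) {u w : List Bool} (h : pathVal w < pathVal u) :
    MinorsNonneg (transfer m u) (transfer m w) := by
  induction w generalizing u with
  | nil =>
    match u with
    | [] => exact absurd h (lt_irrefl _)
    | false :: u => exact absurd h (pathVal_false_lt_one u).not_gt
    | true :: u =>
      exact minorsNonneg_of_monotone_of_antitone (transfer_mem m _) (transfer_mem m _)
        (transfer_true_sub_mem u) fun i j _ => transfer_nil_sub_mem j i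
  | cons b w ih =>
    match b, u with
    | false, [] =>
      exact minorsNonneg_of_monotone_of_antitone (transfer_mem m _) (transfer_mem m _)
        (fun i j _ => transfer_nil_sub_mem i j) (transfer_false_sub_mem w)
    | true, [] => exact absurd h (one_lt_pathVal_true w).not_gt
    | false, true :: u =>
      exact minorsNonneg_of_monotone_of_antitone (transfer_mem m _) (transfer_mem m _)
        (transfer_true_sub_mem u) (transfer_false_sub_mem w)
    | true, false :: u =>
      exact absurd h ((pathVal_false_lt_one u).trans (one_lt_pathVal_true w)).not_gt
    | true, true :: u =>
      refine (ih (u := u) ?_).weightedSum_stepRange true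
      simpa [pathVal] using h
    | false, false :: u =>
      refine (ih (u := u) ?_).weightedSum_stepRange false
      have hu := pathVal_pos u
      have hw := pathVal_pos w
      rw [pathVal, pathVal, div_lt_div_iff₀ (by positivity) (by positivity)] at h
      linarith

lemma fullSteps_not (a : List ℕ) (b : Bool) : fullSteps a (!b) = (fullSteps a b).map not := by
  induction a generalizing b with
  | nil => rfl
  | cons x xs ih => simp [fullSteps, ← ih]

lemma length_fullSteps (a : List ℕ) (b : Bool) : (fullSteps a b).length = a.sum := by
  induction a generalizing b with
  | nil => rfl
  | cons x xs ih => simp [fullSteps, ih]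

lemma cfVal_eq_pathVal {a : List ℕ} (ha : a ≠ []) (hpos : ∀ x ∈ a, 0 < x) :
    cfVal a = pathVal (fullSteps a true).dropLast := by
  induction a with
  | nil => exact absurd rfl ha
  | cons x xs ih =>
    cases xs with
    | nil =>
      obtain ⟨n, rfl⟩ : ∃ n, x = n + 1 := ⟨x - 1, by have := hpos x (by simp); omega⟩
      have := pathVal_replicate_true_append n []
      simp only [List.append_nil] at this
      simp [fullSteps, cfVal, this, pathVal]
    | cons y ys =>
      have hne : fullSteps (y :: ys) false ≠ [] := by
        have := hpos y (by simp)
        rw [ne_eq, ← List.length_eq_zero_iff, length_fullSteps, List.sum_cons]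
        omega
      rw [cfVal, ih (by simp) fun z hz => hpos z (List.mem_cons_of_mem _ hz),
        show fullSteps (x :: y :: ys) true =
          List.replicate x true ++ fullSteps (y :: ys) (!true) from rfl,
        Bool.not_true, List.dropLast_append_of_ne_nil hne, pathVal_replicate_true_append]
      have h := fullSteps_not (y :: ys) true
      rw [Bool.not_true] at h
      rw [h, ← List.map_dropLast, pathVal_map_not, one_div]

/-! ### P-partitions and the transfer recursion -/

/-- `x, σ 0, σ 1, …` follows the word `w`. -/
def Follows {m N : ℕ} (w : List Bool) (x : Fin (m + 1)) (σ : Fin N → Fin (m + 1)) : Prop :=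
  ∀ t : Fin N, (Fin.cons x σ : Fin (N + 1) → Fin (m + 1)) t.succ ∈
    stepRange (w.getD t true) ((Fin.cons x σ : Fin (N + 1) → Fin (m + 1)) t.castSucc)

lemma follows_cons {m N : ℕ} (b : Bool) (w : List Bool) (x y : Fin (m + 1))
    (σ : Fin N → Fin (m + 1)) :
    Follows (b :: w) x (Fin.cons y σ : Fin (N + 1) → Fin (m + 1)) ↔
      y ∈ stepRange b x ∧ Follows w y σ := by
  simp [Follows, Fin.forall_fin_succ (n := N)]

open Classical in
lemma transfer_eq_sum {m N : ℕ} (w : List Bool) (hw : w.length = N) (x : Fin (m + 1)) :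
    transfer m w x =
      ∑ σ : Fin N → Fin (m + 1), if Follows w x σ then (X : ℤ[X]) ^ wt σ else 0 := by
  induction w generalizing N x with
  | nil =>
    subst hw
    simp [transfer, Follows, wt]
  | cons b w ih =>
    obtain _ | N := N
    · simp at hw
    rw [← (Fin.consEquiv fun _ : Fin (N + 1) => Fin (m + 1)).sum_comp, Fintype.sum_prod_type,
      transfer, weightedSum, ← Finset.sum_filter_add_sum_filter_not univ (· ∈ stepRange b x)]
    rw [Finset.sum_eq_zero (s := univ.filter (· ∉ stepRange b x)), add_zero,
      Finset.filter_univ_mem]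
    · refine Finset.sum_congr rfl fun y hy => ?_
      rw [ih (by simpa using hw) y, Finset.mul_sum]
      refine Finset.sum_congr rfl fun σ _ => ?_
      simp [Fin.consEquiv, follows_cons, hy, wt, Fin.sum_univ_succ, pow_add]
    · intro y hy
      refine Finset.sum_eq_zero fun σ _ => ?_
      rw [Finset.mem_filter] at hy
      simp [Fin.consEquiv, follows_cons, hy.2]

lemma fullSteps_dropLast_getD_zero (a : List ℕ) (hpos : ∀ x ∈ a, 0 < x) :
    (fullSteps a true).dropLast.getD 0 true = true := by
  cases a with
  | nil => rfl
  | cons x xs =>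
    obtain ⟨n, rfl⟩ : ∃ n, x = n + 1 := ⟨x - 1, by have := hpos x (by simp); omega⟩
    rw [fullSteps, List.replicate_succ, List.cons_append]
    cases List.replicate n true ++ fullSteps xs (!true) <;> rfl

lemma steps_getD (a : List ℕ) (t : ℕ) :
    (steps a).getD t true = (fullSteps a true).dropLast.getD (t + 1) true := by
  rw [steps, List.drop_one, ← List.tail_dropLast]
  cases (fullSteps a true).dropLast <;> simp

lemma mem_stepRange {m : ℕ} (b : Bool) (x y : Fin (m + 1)) :
    y ∈ stepRange b x ↔ if b then (y : ℕ) ≤ x else (x : ℕ) ≤ y := by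
  cases b <;> simp [stepRange]

lemma follows_iff {m : ℕ} {a : List ℕ} (hpos : ∀ x ∈ a, 0 < x) (x : Fin (m + 1))
    (σ : Fin (boxCount a) → Fin (m + 1)) :
    Follows (fullSteps a true).dropLast x σ ↔
      IsPP m a σ ∧ ∀ h : 0 < boxCount a, (σ ⟨0, h⟩ : ℕ) ≤ x := by
  constructor
  · refine fun h => ⟨fun t ht => ?_, fun h0 => ?_⟩
    · have := h ⟨t + 1, ht⟩
      rw [mem_stepRange, ← steps_getD] at this
      exact this
    · have := h ⟨0, h0⟩
      rw [fullSteps_dropLast_getD_zero a hpos, mem_stepRange] at this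
      exact this
  · rintro ⟨h, h0⟩ ⟨t, ht⟩
    obtain _ | t := t
    · rw [fullSteps_dropLast_getD_zero a hpos, mem_stepRange]
      exact h0 ht
    · rw [mem_stepRange, ← steps_getD]
      exact h t ht

lemma OmegaLE_eq_transfer {m : ℕ} {a : List ℕ} (hpos : ∀ x ∈ a, 0 < x) (x : Fin (m + 1)) :
    OmegaLE m a x m = transfer m (fullSteps a true).dropLast x := by
  rw [transfer_eq_sum (N := boxCount a) _ (by simp [length_fullSteps, boxCount]),
    ← Finset.sum_filter, OmegaLE, PPgen, PP]
  refine Finset.sum_congr ?_ fun _ _ => rfl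
  ext σ
  have hlast : ∀ t, (σ t : ℕ) ≤ m := fun t => Nat.le_of_lt_succ (σ t).2
  simp [follows_iff hpos, hlast]

end QHCF

/-- Theorem C: positivity.  If `v(c₁,…,c_p) > v(d₁,…,d_r) ≥ 1`,
then with `ℛ = Ω_m^{m+1−i,1}(𝒢,q)`, `𝒮 = Ω_m^{m+1,1}(𝒢,q)`, `𝒜 = Ω_m^{m+1−i,1}(𝒢',q)`,
`ℬ = Ω_m^{m+1,1}(𝒢',q)` (so first-part bounds `i`, `0`, `i`, `0` and last-part bound
`m`), the polynomial `ℛ·ℬ − 𝒜·𝒮 ∈ ℤ[q]` has all coefficients nonnegative. -/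
theorem statement15 (m : ℕ) (hm : 1 ≤ m) (i : ℕ) (hi : i ≤ m)
    (c d : List ℕ) (hc : c ≠ []) (hd : d ≠ [])
    (hcpos : ∀ x ∈ c, 0 < x) (hdpos : ∀ x ∈ d, 0 < x)
    (hd1 : 1 ≤ cfVal d) (hlt : cfVal d < cfVal c) :
    ∀ k : ℕ, 0 ≤ (OmegaLE m c i m * OmegaLE m d 0 m -
      OmegaLE m d i m * OmegaLE m c 0 m).coeff k := by
  intro k
  have hval : pathVal (fullSteps d true).dropLast < pathVal (fullSteps c true).dropLast := by
    rwa [← cfVal_eq_pathVal hc hcpos, ← cfVal_eq_pathVal hd hdpos]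
  have h := minorsNonneg_transfer m hval (Fin.zero_le ⟨i, Nat.lt_succ_of_le hi⟩)
  simp only [← OmegaLE_eq_transfer hcpos, ← OmegaLE_eq_transfer hdpos] at h
  exact coeff_nonneg_of_mem h k
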